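/- arXiv:1105.0190 — 3 statements merged into one kernel-verified Lean document; each statement's English description precedes it below -/
import Mathlib

section
/- Suppose S ⊆ ℝⁿ is compact, f : ℝⁿ × ℝᴸ → ℝ is continuous on S × [a₀,b₀] and monotone in interference, and g : ℝⁿ → ℝᴸ is continuous. Then for every ε > 0 there exists δ > 0 such that for all a, b with a₀ ≤ a ≤ b ≤ b₀ componentwise and ‖b − a‖ ≤ δ, and every minimizer Q* of f(·, a) over the (assumed nonempty) sliced feasible set S_{[a,b]}, one has 0 ≤ U_B([a,b]) − L_B([a,b]) ≤ ε; i.e., the bound gap shrinks uniformly with the size of the rectangle. -/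
/-- Uniform shrinking of the bound gap: if `S` is compact, `f` is continuous on
`S × [a₀,b₀]` and monotone in interference, and `g` is continuous, then for
every `ε > 0` there is `δ > 0` such that for every rectangle `[a,b] ⊆ [a₀,b₀]`
with `‖b - a‖ ≤ δ` and every minimizer `Q*` of `f(·, a)` over `S_{[a,b]}`,
the gap `U_B([a,b]) - L_B([a,b]) = f(Q*, g(Q*)) - f(Q*, a)` lies in `[0, ε]`. -/
theorem bound_gap_uniformly_small {n L : ℕ}
    (S : Set (Fin n → ℝ)) (hS : IsCompact S)
    (g : (Fin n → ℝ) → (Fin L → ℝ)) (hg : Continuous g)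
    (f : (Fin n → ℝ) → (Fin L → ℝ) → ℝ)
    (a₀ b₀ : Fin L → ℝ)
    (hfcont : ContinuousOn (fun p : (Fin n → ℝ) × (Fin L → ℝ) => f p.1 p.2)
      (S ×ˢ Set.Icc a₀ b₀))
    (hmono : ∀ (Q : Fin n → ℝ) (i i' : Fin L → ℝ), i ≤ i' → f Q i ≤ f Q i') :
    ∀ ε > (0 : ℝ), ∃ δ > (0 : ℝ), ∀ a b : Fin L → ℝ,
      a₀ ≤ a → a ≤ b → b ≤ b₀ → ‖b - a‖ ≤ δ →
      ∀ Qstar : Fin n → ℝ,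
        Qstar ∈ {Q ∈ S | a ≤ g Q ∧ g Q ≤ b} →
        (∀ Q ∈ {Q ∈ S | a ≤ g Q ∧ g Q ≤ b}, f Qstar a ≤ f Q a) →
        0 ≤ f Qstar (g Qstar) - f Qstar a ∧
          f Qstar (g Qstar) - f Qstar a ≤ ε := by
  intro ε hε
  have huc := (hS.prod isCompact_Icc).uniformContinuousOn_of_continuous hfcont
  obtain ⟨δ, hδ, hclose⟩ := Metric.uniformContinuousOn_iff.mp huc ε hε
  refine ⟨δ / 2, half_pos hδ, ?_⟩
  rintro a b ha hab hb hnorm Q ⟨hQS, haQ, hQb⟩ -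
  refine ⟨sub_nonneg.mpr (hmono Q a (g Q) haQ), ?_⟩
  have hdist : dist (Q, g Q) (Q, a) < δ := by
    rw [dist_prod_same_left]
    refine lt_of_le_of_lt ?_ (half_lt_self hδ)
    refine (dist_pi_le_iff (half_pos hδ).le).mpr fun j => ?_
    have hj := (Real.le_norm_self _).trans ((norm_le_pi_norm (b - a) j).trans hnorm)
    rw [Pi.sub_apply] at hj
    rw [Real.dist_eq, abs_of_nonneg (sub_nonneg.mpr (haQ j))]
    linarith [hQb j]
  have hlt := hclose (Q, g Q) ⟨hQS, ha.trans haQ, hQb.trans hb⟩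
    (Q, a) ⟨hQS, ha, hab.trans hb⟩ hdist
  rw [Real.dist_eq] at hlt
  exact (le_abs_self _).trans hlt.le
end

section
/- Suppose S ⊆ ℝⁿ is compact, g : ℝⁿ → ℝᴸ is continuous, and f : ℝⁿ × ℝᴸ → ℝ is continuous on S × [a₀,b₀] and monotone in interference. Let (aₜ) and (bₜ) be sequences in ℝᴸ with a₀ ≤ aₜ ≤ aₜ₊₁ ≤ bₜ₊₁ ≤ bₜ ≤ b₀ componentwise (nested rectangles) and ‖bₜ − aₜ‖ → 0, and suppose each sliced feasible set S_{[aₜ,bₜ]} is nonempty with a minimizer Q*ₜ of f(·, aₜ) over it. Then U_B([aₜ,bₜ]) − L_B([aₜ,bₜ]) → 0 as t → ∞; i.e., along any collapsing nested sequence of rectangles produced by branch-and-bound, the upper and lower bounds converge to a common value. -/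
/-- Along any collapsing nested sequence of rectangles `[aₜ, bₜ]` produced by
branch-and-bound, the gap between the upper bound `U_B([aₜ,bₜ]) = f(Q*ₜ, g(Q*ₜ))`
and the lower bound `L_B([aₜ,bₜ]) = f(Q*ₜ, aₜ)` converges to zero. -/
theorem bound_gap_tendsto_zero {n L : ℕ}
    (S : Set (Fin n → ℝ)) (hS : IsCompact S)
    (g : (Fin n → ℝ) → (Fin L → ℝ)) (hg : Continuous g)
    (f : (Fin n → ℝ) → (Fin L → ℝ) → ℝ)
    (a₀ b₀ : Fin L → ℝ)
    (hfcont : ContinuousOn (fun p : (Fin n → ℝ) × (Fin L → ℝ) => f p.1 p.2)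
      (S ×ˢ Set.Icc a₀ b₀))
    (hmono : ∀ (Q : Fin n → ℝ) (i i' : Fin L → ℝ), i ≤ i' → f Q i ≤ f Q i')
    (a b : ℕ → (Fin L → ℝ))
    (ha₀ : ∀ t, a₀ ≤ a t) (hamono : Monotone a)
    (hab : ∀ t, a t ≤ b t)
    (hbanti : Antitone b) (hb₀ : ∀ t, b t ≤ b₀)
    (hcollapse : Filter.Tendsto (fun t => ‖b t - a t‖) Filter.atTop (nhds 0))
    (Qstar : ℕ → (Fin n → ℝ))
    (hQmem : ∀ t, Qstar t ∈ {Q ∈ S | a t ≤ g Q ∧ g Q ≤ b t})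
    (hQmin : ∀ t, ∀ Q ∈ {Q ∈ S | a t ≤ g Q ∧ g Q ≤ b t},
      f (Qstar t) (a t) ≤ f Q (a t)) :
    Filter.Tendsto
      (fun t => f (Qstar t) (g (Qstar t)) - f (Qstar t) (a t))
      Filter.atTop (nhds 0) := by
  have hunif := (hS.prod isCompact_Icc).uniformContinuousOn_of_continuous hfcont
  rw [Metric.uniformContinuousOn_iff] at hunif
  rw [Metric.tendsto_nhds]
  intro ε hε
  obtain ⟨δ, hδ, hf⟩ := hunif ε hε
  filter_upwards [hcollapse.eventually_lt_const hδ] with t ht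
  obtain ⟨hQS, hag, hgb⟩ := hQmem t
  have hdist : dist (g (Qstar t)) (a t) < δ := by
    refine lt_of_le_of_lt ?_ ht
    rw [dist_eq_norm, pi_norm_le_iff_of_nonneg (norm_nonneg _)]
    intro i
    refine le_trans ?_ (norm_le_pi_norm (b t - a t) i)
    rw [Pi.sub_apply, Pi.sub_apply, Real.norm_of_nonneg (sub_nonneg.2 (hag i)),
      Real.norm_of_nonneg (sub_nonneg.2 (hab t i))]
    exact sub_le_sub_right (hgb i) _
  have hgap := hf (Qstar t, g (Qstar t)) ⟨hQS, (ha₀ t).trans hag, hgb.trans (hb₀ t)⟩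
    (Qstar t, a t) ⟨hQS, ha₀ t, (hab t).trans (hb₀ t)⟩ (by simpa [Prod.dist_eq, hδ] using hdist)
  simpa [Real.dist_eq] using hgap
end

section
/- Let S ⊆ ℝⁿ be convex, g : ℝⁿ → ℝᴸ affine (g(Q) = A(Q) + c, A linear), and f : ℝⁿ × ℝᴸ → ℝ Fréchet differentiable with f(·, i) convex for each fixed i ∈ ℝᴸ. Suppose (Q*, λ̂) is a fixed point of the pricing algorithm: setting î := g(Q*), (i) Q* minimizes Q ↦ f(Q, î) + ⟨λ̂, g(Q)⟩ over S, and (ii) λ̂ equals the gradient of i ↦ f(Q*, i) at î. Then Q* is a stationary point of the original problem: for every Q ∈ S, the derivative at t = 0 of the function t ↦ f(Q* + t(Q − Q*), g(Q* + t(Q − Q*))) is nonnegative. -/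
/-- A fixed point `(Q*, λ̂)` of the pricing algorithm is a stationary point of
the original problem: if `Q*` minimizes `Q ↦ f(Q, î) + ⟨λ̂, g(Q)⟩` over the
convex set `S` with `î = g(Q*)`, and `λ̂` is the gradient of `i ↦ f(Q*, i)` at
`î`, then for every `Q ∈ S` the derivative at `t = 0` of
`t ↦ f(Q* + t(Q − Q*), g(Q* + t(Q − Q*)))` is nonnegative. -/
theorem pricing_fixed_point_is_stationary {n L : ℕ}
    (S : Set (Fin n → ℝ)) (hS : Convex ℝ S)
    (A : (Fin n → ℝ) →ₗ[ℝ] (Fin L → ℝ)) (c : Fin L → ℝ)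
    (g : (Fin n → ℝ) → (Fin L → ℝ)) (hg : ∀ Q, g Q = A Q + c)
    (f : (Fin n → ℝ) → (Fin L → ℝ) → ℝ)
    (hdiff : Differentiable ℝ (fun p : (Fin n → ℝ) × (Fin L → ℝ) => f p.1 p.2))
    (hconv : ∀ i : Fin L → ℝ, ConvexOn ℝ Set.univ (fun Q => f Q i))
    (Qstar : Fin n → ℝ) (hQmem : Qstar ∈ S)
    (lamhat : Fin L → ℝ)
    (hfix1 : ∀ Q ∈ S,
      f Qstar (g Qstar) + ∑ j, lamhat j * g Qstar j ≤
        f Q (g Qstar) + ∑ j, lamhat j * g Q j)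
    (hfix2 : ∀ v : Fin L → ℝ,
      fderiv ℝ (fun i => f Qstar i) (g Qstar) v = ∑ j, lamhat j * v j) :
    ∀ Q ∈ S,
      0 ≤ deriv (fun t : ℝ =>
        f (Qstar + t • (Q - Qstar)) (g (Qstar + t • (Q - Qstar)))) 0 := by
  intro Q hQ
  set d := Q - Qstar
  obtain ⟨D, hD⟩ := hdiff (Qstar, g Qstar)
  have hg_line : ∀ t : ℝ, g (Qstar + t • d) = g Qstar + t • A d := by
    intro t
    rw [hg, hg, map_add, map_smul]
    abel
  have hline : HasDerivAt (fun t : ℝ => Qstar + t • d) d 0 := by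
    simpa using ((hasDerivAt_id (0 : ℝ)).smul_const d).const_add Qstar
  have hgline : HasDerivAt (fun t : ℝ => g Qstar + t • A d) (A d) 0 := by
    simpa using ((hasDerivAt_id (0 : ℝ)).smul_const (A d)).const_add (g Qstar)
  have hderiv : HasDerivAt (fun t : ℝ => f (Qstar + t • d) (g (Qstar + t • d)))
      (D (d, A d)) 0 := by
    simp only [hg_line]
    exact HasFDerivAt.comp_hasDerivAt_of_eq (0 : ℝ) hD (hline.prodMk hgline) (by simp)
  have hprice : D (0, A d) = ∑ j, lamhat j * A d j := by
    have h : HasFDerivAt (fun i => f Qstar i)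
        (D.comp (ContinuousLinearMap.inr ℝ (Fin n → ℝ) (Fin L → ℝ))) (g Qstar) :=
      HasFDerivAt.comp (g Qstar) hD (hasFDerivAt_prodMk_right Qstar (g Qstar))
    rw [← hfix2, h.fderiv]
    simp
  have hpriced : HasDerivAt
      (fun t : ℝ => f (Qstar + t • d) (g Qstar) + ∑ j, lamhat j * g (Qstar + t • d) j)
      (D (d, 0) + ∑ j, lamhat j * A d j) 0 := by
    refine HasDerivAt.add ?_ (HasDerivAt.fun_sum fun j _ => ?_)
    · exact HasFDerivAt.comp_hasDerivAt_of_eq (0 : ℝ) hD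
        (hline.prodMk (hasDerivAt_const 0 (g Qstar))) (by simp)
    · simp only [hg_line]
      exact (hasDerivAt_pi.1 hgline j).const_mul _
  have hmin : IsMinOn
      (fun t : ℝ => f (Qstar + t • d) (g Qstar) + ∑ j, lamhat j * g (Qstar + t • d) j)
      (Set.Icc 0 1) 0 := by
    intro t ht
    simpa using hfix1 _ (hS.add_smul_sub_mem hQmem hQ ht)
  have hcone : (1 : ℝ) ∈ posTangentConeAt (Set.Icc (0 : ℝ) 1) 0 :=
    mem_posTangentConeAt_of_segment_subset (by simp [segment_eq_Icc])
  have hnonneg : 0 ≤ D (d, 0) + ∑ j, lamhat j * A d j := by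
    simpa using hmin.localize.hasFDerivWithinAt_nonneg
      hpriced.hasFDerivAt.hasFDerivWithinAt hcone
  have hsplit : D (d, A d) = D (d, 0) + D (0, A d) := by
    rw [← map_add]
    simp
  rw [hderiv.deriv, hsplit, hprice]
  exact hnonneg
end
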